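/- Suppose ∫ l_N dμᴺ → 0 as N → ∞. Then every stopping rule ψ is truncatable, i.e. R_N(ψ) → R(ψ) as N → ∞. -/

import Mathlib

open MeasureTheory ENNReal Filter ProbabilityTheory

namespace SDP

variable {Θ X D : Type*} [MeasurableSpace Θ] [MeasurableSpace X] [MeasurableSpace D]

/-- The product measure `μⁿ` on `Xⁿ`. -/
noncomputable def pm (μ : Measure X) (n : ℕ) : Measure (Fin n → X) :=
  Measure.pi fun _ => μ

/-- `t_n^ψ = (1-ψ₁)⋯(1-ψ_{n-1})`, with `t₁^ψ ≡ 1`. -/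
noncomputable def t (ψ : ∀ n, (Fin n → X) → ℝ≥0∞) : ∀ n, (Fin n → X) → ℝ≥0∞
  | 0, _ => 1
  | 1, _ => 1
  | n + 2, x => t ψ (n + 1) (Fin.init x) * (1 - ψ (n + 1) (Fin.init x))

/-- `s_n^ψ = (1-ψ₁)⋯(1-ψ_{n-1})ψ_n`. -/
noncomputable def s (ψ : ∀ n, (Fin n → X) → ℝ≥0∞) (n : ℕ) (x : Fin n → X) : ℝ≥0∞ :=
  t ψ n x * ψ n x

/-- A stopping rule: a sequence of measurable functions with values in `[0,1]`. -/
def IsStoppingRule (ψ : ∀ n, (Fin n → X) → ℝ≥0∞) : Prop :=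
  (∀ n, Measurable (ψ n)) ∧ ∀ n x, ψ n x ≤ 1

/-- A decision rule: a sequence of measurable functions with values in `D`. -/
def IsDecisionRule (δ : ∀ n, (Fin n → X) → D) : Prop := ∀ n, Measurable (δ n)

/-- `ψ` is truncated at `N`: `ψ_n ≡ 1` for all `n ≥ N`. -/
def TruncatedAt (ψ : ∀ n, (Fin n → X) → ℝ≥0∞) (N : ℕ) : Prop :=
  ∀ n, N ≤ n → ∀ x, ψ n x = 1

/-- A consistent family of joint probability densities `f_θⁿ` w.r.t. `μⁿ`. -/
def IsDensityFamily (μ : Measure X) (f : Θ → ∀ n, (Fin n → X) → ℝ≥0∞) : Prop :=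
  (∀ n, Measurable fun p : Θ × (Fin n → X) => f p.1 n p.2) ∧
  (∀ θ x, f θ 0 x = 1) ∧
  (∀ θ n, ∫⁻ x, f θ n x ∂pm μ n = 1) ∧
  ∀ θ n (x : Fin n → X), ∫⁻ y, f θ (n + 1) (Fin.snoc x y) ∂μ = f θ n x

/-- The average loss `W(ψ,δ)`. -/
noncomputable def W (π₁ : Measure Θ) (μ : Measure X) (w : Θ → D → ℝ≥0∞)
    (f : Θ → ∀ n, (Fin n → X) → ℝ≥0∞) (ψ : ∀ n, (Fin n → X) → ℝ≥0∞)
    (δ : ∀ n, (Fin n → X) → D) : ℝ≥0∞ :=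
  ∑' n : ℕ, ∫⁻ θ, ∫⁻ x, s ψ (n + 1) x * w θ (δ (n + 1) x) * f θ (n + 1) x ∂pm μ (n + 1) ∂π₁

/-- The partial average loss `W_i(ψ,δ)` (integration over `Θᵢ`). -/
noncomputable def Wi (π₁ : Measure Θ) (μ : Measure X) (w : Θ → D → ℝ≥0∞)
    (f : Θ → ∀ n, (Fin n → X) → ℝ≥0∞) (Θi : Set Θ) (ψ : ∀ n, (Fin n → X) → ℝ≥0∞)
    (δ : ∀ n, (Fin n → X) → D) : ℝ≥0∞ :=
  ∑' n : ℕ,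
    ∫⁻ θ in Θi, ∫⁻ x, s ψ (n + 1) x * w θ (δ (n + 1) x) * f θ (n + 1) x ∂pm μ (n + 1) ∂π₁

/-- `P^{π}(τ_ψ = n)`. -/
noncomputable def PtauEq (π₂ : Measure Θ) (μ : Measure X)
    (f : Θ → ∀ n, (Fin n → X) → ℝ≥0∞) (ψ : ∀ n, (Fin n → X) → ℝ≥0∞) (n : ℕ) : ℝ≥0∞ :=
  ∫⁻ θ, ∫⁻ x, s ψ n x * f θ n x ∂pm μ n ∂π₂

/-- `P^{π}(τ_ψ < ∞)`. -/
noncomputable def Pfin (π₂ : Measure Θ) (μ : Measure X)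
    (f : Θ → ∀ n, (Fin n → X) → ℝ≥0∞) (ψ : ∀ n, (Fin n → X) → ℝ≥0∞) : ℝ≥0∞ :=
  ∑' n : ℕ, PtauEq π₂ μ f ψ (n + 1)

/-- The average sample number `N(ψ)` (equal to `∞` if `P^{π₂}(τ_ψ < ∞) < 1`). -/
noncomputable def ASN (π₂ : Measure Θ) (μ : Measure X)
    (f : Θ → ∀ n, (Fin n → X) → ℝ≥0∞) (ψ : ∀ n, (Fin n → X) → ℝ≥0∞) : ℝ≥0∞ :=
  if Pfin π₂ μ f ψ = 1 then ∑' n : ℕ, ((n : ℝ≥0∞) + 1) * PtauEq π₂ μ f ψ (n + 1) else ⊤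

/-- `fⁿ = ∫_Θ f_θⁿ dπ₂(θ)` (in particular `f⁰ ≡ 1`). -/
noncomputable def fbar (π₂ : Measure Θ) (f : Θ → ∀ n, (Fin n → X) → ℝ≥0∞)
    (n : ℕ) (x : Fin n → X) : ℝ≥0∞ :=
  ∫⁻ θ, f θ n x ∂π₂

/-- `R(ψ) = Σₙ ∫ sₙ^ψ (c n fⁿ + lₙ) dμⁿ` if `P^{π₂}(τ_ψ<∞) = 1`, `∞` otherwise. -/
noncomputable def R (π₂ : Measure Θ) (μ : Measure X) (c : ℝ≥0∞)
    (f : Θ → ∀ n, (Fin n → X) → ℝ≥0∞) (l : ∀ n, (Fin n → X) → ℝ≥0∞)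
    (ψ : ∀ n, (Fin n → X) → ℝ≥0∞) : ℝ≥0∞ :=
  if Pfin π₂ μ f ψ = 1 then
    ∑' n : ℕ, ∫⁻ x, s ψ (n + 1) x *
      (c * ((n : ℝ≥0∞) + 1) * fbar π₂ f (n + 1) x + l (n + 1) x) ∂pm μ (n + 1)
  else ⊤

/-- `R_N(ψ)`, the risk of `ψ` truncated at `N`. -/
noncomputable def RN (π₂ : Measure Θ) (μ : Measure X) (c : ℝ≥0∞)
    (f : Θ → ∀ n, (Fin n → X) → ℝ≥0∞) (l : ∀ n, (Fin n → X) → ℝ≥0∞)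
    (N : ℕ) (ψ : ∀ n, (Fin n → X) → ℝ≥0∞) : ℝ≥0∞ :=
  (∑ n ∈ Finset.range (N - 1), ∫⁻ x, s ψ (n + 1) x *
      (c * ((n : ℝ≥0∞) + 1) * fbar π₂ f (n + 1) x + l (n + 1) x) ∂pm μ (n + 1)) +
  ∫⁻ x, t ψ N x * (c * (N : ℝ≥0∞) * fbar π₂ f N x + l N x) ∂pm μ N

/-- `Vₙᴺ`, defined backwards from `V_Nᴺ = l_N` by `Vₙᴺ = min{lₙ, Qₙᴺ}`. -/
noncomputable def V (μ : Measure X) (c : ℝ≥0∞) (fb l : ∀ n, (Fin n → X) → ℝ≥0∞)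
    (N n : ℕ) (x : Fin n → X) : ℝ≥0∞ :=
  if h : n < N then
    min (l n x) (c * fb n x + ∫⁻ y, V μ c fb l N (n + 1) (Fin.snoc x y) ∂μ)
  else l n x
termination_by N - n
decreasing_by omega

/-- `Qₙᴺ = c fⁿ + ∫ Vₙ₊₁ᴺ(⋅,y) dμ(y)`. -/
noncomputable def Q (μ : Measure X) (c : ℝ≥0∞) (fb l : ∀ n, (Fin n → X) → ℝ≥0∞)
    (N n : ℕ) (x : Fin n → X) : ℝ≥0∞ :=
  c * fb n x + ∫⁻ y, V μ c fb l N (n + 1) (Fin.snoc x y) ∂μ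

/-- `Vₙ = lim_{N→∞} Vₙᴺ` (the sequence is nonincreasing in `N`, so the limit is the inf). -/
noncomputable def Vlim (μ : Measure X) (c : ℝ≥0∞) (fb l : ∀ n, (Fin n → X) → ℝ≥0∞)
    (n : ℕ) (x : Fin n → X) : ℝ≥0∞ :=
  ⨅ N, V μ c fb l N n x

/-- `Qₙ = lim_{N→∞} Qₙᴺ = c fⁿ + ∫ Vₙ₊₁(⋅,y) dμ(y)`. -/
noncomputable def Qlim (μ : Measure X) (c : ℝ≥0∞) (fb l : ∀ n, (Fin n → X) → ℝ≥0∞)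
    (n : ℕ) (x : Fin n → X) : ℝ≥0∞ :=
  c * fb n x + ∫⁻ y, Vlim μ c fb l (n + 1) (Fin.snoc x y) ∂μ

end SDP

namespace SDP

variable {Θ X : Type*} [MeasurableSpace Θ] [MeasurableSpace X]

theorem measurable_finInit (n : ℕ) :
    Measurable (Fin.init : (Fin (n + 1) → X) → (Fin n → X)) :=
  measurable_pi_lambda _ fun _ => measurable_pi_apply _

theorem IsStoppingRule.measurable_t {ψ : ∀ n, (Fin n → X) → ℝ≥0∞} (hψ : IsStoppingRule ψ) :
    ∀ n, Measurable (t ψ n)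
  | 0 => by
    have : t ψ 0 = fun _ => 1 := by funext x; simp [t]
    rw [this]; exact measurable_const
  | 1 => by
    have : t ψ 1 = fun _ => 1 := by funext x; simp [t]
    rw [this]; exact measurable_const
  | n + 2 => by
    have : t ψ (n + 2) = fun x =>
        t ψ (n + 1) (Fin.init x) * (1 - ψ (n + 1) (Fin.init x)) := by funext x; simp [t]
    rw [this]
    exact ((hψ.measurable_t (n + 1)).comp (measurable_finInit _)).mul
      (measurable_const.sub ((hψ.1 (n + 1)).comp (measurable_finInit _)))

theorem IsStoppingRule.measurable_s {ψ : ∀ n, (Fin n → X) → ℝ≥0∞} (hψ : IsStoppingRule ψ)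
    (n : ℕ) : Measurable (s ψ n) :=
  (hψ.measurable_t n).mul (hψ.1 n)

theorem t_le_one {Y : Type*} (ψ : ∀ n, (Fin n → Y) → ℝ≥0∞) : ∀ n x, t ψ n x ≤ 1
  | 0, _ => by simp [t]
  | 1, _ => by simp [t]
  | n + 2, x => by
    rw [t]
    exact mul_le_one' (t_le_one ψ (n + 1) _) tsub_le_self

theorem lintegral_pm_succ (μ : Measure X) [SigmaFinite μ] (n : ℕ)
    {g : (Fin (n + 1) → X) → ℝ≥0∞} (hg : Measurable g) :
    ∫⁻ x, g x ∂pm μ (n + 1) = ∫⁻ x, ∫⁻ y, g (Fin.snoc x y) ∂μ ∂pm μ n := by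
  have hp := (measurePreserving_piFinSuccAbove (fun _ : Fin (n + 1) => μ) (Fin.last n)).symm
  have hsnoc (y : X) (x : Fin n → X) :
      (MeasurableEquiv.piFinSuccAbove (fun _ => X) (Fin.last n)).symm (y, x) = Fin.snoc x y := by
    simp [MeasurableEquiv.piFinSuccAbove, Fin.insertNthEquiv, Fin.insertNth_last']
  have hm := hg.comp (MeasurableEquiv.piFinSuccAbove (fun _ => X) (Fin.last n)).symm.measurable
  unfold pm
  rw [← hp.lintegral_comp hg]
  refine (lintegral_prod_symm _ hm.aemeasurable).trans ?_
  exact lintegral_congr fun x => lintegral_congr fun y => congrArg g (hsnoc y x)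

theorem measurable_finSnoc (n : ℕ) (x : Fin n → X) :
    Measurable fun y : X => (Fin.snoc x y : Fin (n + 1) → X) := by
  refine measurable_pi_lambda _ fun i => ?_
  refine Fin.lastCases ?_ (fun j => ?_) i
  · simpa using measurable_id'
  · simp

variable {μ : Measure X} {π : Measure Θ} [IsProbabilityMeasure π]
  {f : Θ → ∀ n, (Fin n → X) → ℝ≥0∞}

theorem IsDensityFamily.measurable_fbar (hf : IsDensityFamily μ f) (n : ℕ) :
    Measurable (fbar π f n) :=
  (hf.1 n).lintegral_prod_left'

theorem lintegral_mul_cost (hf : IsDensityFamily μ f) {g : ∀ n, (Fin n → X) → ℝ≥0∞}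
    (hg : ∀ n, Measurable (g n)) (l : ∀ n, (Fin n → X) → ℝ≥0∞) (a : ℝ≥0∞) (n : ℕ) :
    ∫⁻ x, g n x * (a * fbar π f n x + l n x) ∂pm μ n =
      a * ∫⁻ x, g n x * fbar π f n x ∂pm μ n + ∫⁻ x, g n x * l n x ∂pm μ n := by
  have hm : Measurable fun x => g n x * fbar π f n x := (hg n).mul (hf.measurable_fbar n)
  rw [← lintegral_const_mul _ hm, ← lintegral_add_left (hm.const_mul a)]
  refine lintegral_congr fun x => ?_
  ring

variable [SigmaFinite μ]

theorem IsDensityFamily.lintegral_fbar_snoc (hf : IsDensityFamily μ f) (n : ℕ) (x : Fin n → X) :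
    ∫⁻ y, fbar π f (n + 1) (Fin.snoc x y) ∂μ = fbar π f n x := by
  unfold fbar
  rw [lintegral_lintegral_swap]
  · exact lintegral_congr fun θ => hf.2.2.2 θ n x
  · exact ((hf.1 (n + 1)).comp (measurable_snd.prodMk
      ((measurable_finSnoc n x).comp measurable_fst))).aemeasurable

theorem IsDensityFamily.lintegral_mul_fbar_eq (hf : IsDensityFamily μ f) (n : ℕ)
    {g : (Fin n → X) → ℝ≥0∞} (hg : Measurable g) :
    ∫⁻ x, g x * fbar π f n x ∂pm μ n = ∫⁻ θ, ∫⁻ x, g x * f θ n x ∂pm μ n ∂π := by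
  have : SigmaFinite (pm μ n) := by unfold pm; infer_instance
  rw [lintegral_lintegral_swap]
  · refine lintegral_congr fun x => ?_
    rw [lintegral_const_mul]
    · rfl
    · exact (hf.1 n).comp (measurable_id.prodMk measurable_const)
  · exact ((hg.comp measurable_snd).mul (hf.1 n)).aemeasurable

theorem IsDensityFamily.lintegral_fbar (hf : IsDensityFamily μ f) (n : ℕ) :
    ∫⁻ x, fbar π f n x ∂pm μ n = 1 := by
  have h := hf.lintegral_mul_fbar_eq (π := π) n (g := fun _ => 1) measurable_const
  simpa [hf.2.2.1] using h

/-- The probability `P^π(τ_ψ ≥ n)` that sampling reaches stage `n`. -/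
noncomputable def PtauGe (π : Measure Θ) (μ : Measure X)
    (f : Θ → ∀ n, (Fin n → X) → ℝ≥0∞) (ψ : ∀ n, (Fin n → X) → ℝ≥0∞) (n : ℕ) : ℝ≥0∞ :=
  ∫⁻ x, t ψ n x * fbar π f n x ∂pm μ n

variable {ψ : ∀ n, (Fin n → X) → ℝ≥0∞}

theorem PtauEq_eq_lintegral (hf : IsDensityFamily μ f) (hψ : IsStoppingRule ψ) (n : ℕ) :
    PtauEq π μ f ψ n = ∫⁻ x, s ψ n x * fbar π f n x ∂pm μ n :=
  (hf.lintegral_mul_fbar_eq n (hψ.measurable_s n)).symm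

theorem PtauEq_add_PtauGe_succ (hf : IsDensityFamily μ f) (hψ : IsStoppingRule ψ) (n : ℕ) :
    PtauEq π μ f ψ (n + 1) + PtauGe π μ f ψ (n + 2) = PtauGe π μ f ψ (n + 1) := by
  have hsucc : PtauGe π μ f ψ (n + 2) =
      ∫⁻ x, t ψ (n + 1) x * (1 - ψ (n + 1) x) * fbar π f (n + 1) x ∂pm μ (n + 1) := by
    have hm : Measurable fun x => t ψ (n + 2) x * fbar π f (n + 2) x :=
      (hψ.measurable_t _).mul (hf.measurable_fbar _)
    rw [PtauGe, lintegral_pm_succ μ (n + 1) hm]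
    refine lintegral_congr fun x => ?_
    simp only [t, Fin.init_snoc]
    rw [lintegral_const_mul, hf.lintegral_fbar_snoc]
    exact (hf.measurable_fbar _).comp (measurable_finSnoc _ x)
  have hm : Measurable fun x => s ψ (n + 1) x * fbar π f (n + 1) x :=
    (hψ.measurable_s _).mul (hf.measurable_fbar _)
  rw [hsucc, PtauEq_eq_lintegral hf hψ, PtauGe, ← lintegral_add_left hm]
  refine lintegral_congr fun x => ?_
  rw [s, ← add_mul, ← mul_add, add_tsub_cancel_of_le (hψ.2 _ _), mul_one]

theorem sum_PtauEq_add_PtauGe (hf : IsDensityFamily μ f) (hψ : IsStoppingRule ψ) (N : ℕ) :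
    ∑ n ∈ Finset.range N, PtauEq π μ f ψ (n + 1) + PtauGe π μ f ψ (N + 1) = 1 := by
  induction N with
  | zero => simpa [PtauGe, t] using hf.lintegral_fbar (π := π) 1
  | succ N ih => rw [Finset.sum_range_succ, add_assoc, PtauEq_add_PtauGe_succ hf hψ, ih]

theorem Pfin_le_one (hf : IsDensityFamily μ f) (hψ : IsStoppingRule ψ) : Pfin π μ f ψ ≤ 1 :=
  ENNReal.tsum_le_of_sum_range_le fun N =>
    le_self_add.trans (sum_PtauEq_add_PtauGe hf hψ N).le

theorem one_sub_Pfin_le_PtauGe (hf : IsDensityFamily μ f) (hψ : IsStoppingRule ψ) (N : ℕ) :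
    1 - Pfin π μ f ψ ≤ PtauGe π μ f ψ (N + 1) := by
  rw [tsub_le_iff_left, ← sum_PtauEq_add_PtauGe (π := π) hf hψ N]
  gcongr
  exact ENNReal.sum_le_tsum _

theorem PtauGe_eq_tsum (hf : IsDensityFamily μ f) (hψ : IsStoppingRule ψ)
    (h : Pfin π μ f ψ = 1) (N : ℕ) :
    PtauGe π μ f ψ (N + 1) = ∑' n, PtauEq π μ f ψ (n + N + 1) := by
  have h1 := sum_PtauEq_add_PtauGe (π := π) hf hψ N
  have h2 := Summable.sum_add_tsum_nat_add' (k := N)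
    (f := fun n => PtauEq π μ f ψ (n + 1)) ENNReal.summable
  have hne : ∑ n ∈ Finset.range N, PtauEq π μ f ψ (n + 1) ≠ ⊤ :=
    ((le_self_add.trans h1.le).trans_lt ENNReal.one_lt_top).ne
  rw [← ENNReal.add_right_inj hne, h1, h2]
  exact h.symm

end SDP

open SDP MeasureTheory ENNReal Filter in
/-- if `∫ l_N dμᴺ → 0` as `N → ∞`, then every stopping rule is truncatable. -/
theorem statement_13
    {Θ X D : Type*} [MeasurableSpace Θ] [MeasurableSpace X] [MeasurableSpace D]
    (μ : Measure X) [SigmaFinite μ]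
    (π₁ π₂ : Measure Θ) [IsProbabilityMeasure π₁] [IsProbabilityMeasure π₂]
    (f : Θ → ∀ n, (Fin n → X) → ℝ≥0∞) (hf : IsDensityFamily μ f)
    (w : Θ → D → ℝ≥0∞) (hw : Measurable (Function.uncurry w))
    (δB : ∀ n, (Fin n → X) → D) (hδB : IsDecisionRule δB)
    (hBayes : ∀ n (d : D), ∀ᵐ x ∂pm μ n,
      ∫⁻ θ, w θ (δB n x) * f θ n x ∂π₁ ≤ ∫⁻ θ, w θ d * f θ n x ∂π₁)
    (l : ∀ n, (Fin n → X) → ℝ≥0∞)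
    (hl : ∀ n x, l n x = ∫⁻ θ, w θ (δB n x) * f θ n x ∂π₁)
    (hl1 : ∫⁻ x, l 1 x ∂pm μ 1 < ⊤)
    (c : ℝ≥0∞) (hc : 0 < c) (hc' : c ≠ ⊤)
    (hl0 : Tendsto (fun N => ∫⁻ x, l N x ∂pm μ N) atTop (nhds 0)) :
    ∀ ψ : ∀ n, (Fin n → X) → ℝ≥0∞, IsStoppingRule ψ →
      Tendsto (fun N => RN π₂ μ c f l N ψ) atTop (nhds (R π₂ μ c f l ψ)) := by
  intro ψ hψ
  rw [← tendsto_add_atTop_iff_nat 1]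
  set r : ℕ → ℝ≥0∞ := fun n => ∫⁻ x, s ψ (n + 1) x *
      (c * ((n : ℝ≥0∞) + 1) * fbar π₂ f (n + 1) x + l (n + 1) x) ∂pm μ (n + 1) with hr
  have hRN (N : ℕ) : RN π₂ μ c f l (N + 1) ψ = ∑ n ∈ Finset.range N, r n +
      (c * ((N : ℝ≥0∞) + 1) * PtauGe π₂ μ f ψ (N + 1) +
        ∫⁻ x, t ψ (N + 1) x * l (N + 1) x ∂pm μ (N + 1)) := by
    rw [RN, Nat.add_sub_cancel, lintegral_mul_cost hf hψ.measurable_t, PtauGe]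
    push_cast
    rfl
  by_cases hP : Pfin π₂ μ f ψ = 1
  · have hR : R π₂ μ c f l ψ = ∑' n, r n := by rw [R, if_pos hP]
    have hupper : Tendsto (fun N => ∑' n, r n + ∫⁻ x, l (N + 1) x ∂pm μ (N + 1))
        atTop (nhds (∑' n, r n)) := by
      simpa using tendsto_const_nhds.add ((tendsto_add_atTop_iff_nat 1).2 hl0)
    rw [hR]
    refine tendsto_of_tendsto_of_tendsto_of_le_of_le (ENNReal.tendsto_nat_tsum r) hupper
      (fun N => ?_) fun N => ?_
    · simp only [hRN]
      exact le_self_add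
    · simp only [hRN]
      rw [← Summable.sum_add_tsum_nat_add' (k := N) (f := r) ENNReal.summable, add_assoc]
      gcongr with x
      · rw [PtauGe_eq_tsum hf hψ hP, ← ENNReal.tsum_mul_left]
        refine ENNReal.tsum_le_tsum fun n => ?_
        rw [hr]
        simp only
        rw [lintegral_mul_cost hf hψ.measurable_s, ← PtauEq_eq_lintegral hf hψ]
        refine le_trans ?_ le_self_add
        gcongr
        omega
      · exact mul_le_of_le_one_left' (t_le_one ψ _ x)
  · have hR : R π₂ μ c f l ψ = ⊤ := by rw [R, if_neg hP]
    have hpos : c * (1 - Pfin π₂ μ f ψ) ≠ 0 :=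
      mul_ne_zero hc.ne' (tsub_pos_of_lt (lt_of_le_of_ne (Pfin_le_one hf hψ) hP)).ne'
    have hlow : Tendsto (fun N : ℕ => (N : ℝ≥0∞) * (c * (1 - Pfin π₂ μ f ψ)))
        atTop (nhds ⊤) := by
      have h := ENNReal.Tendsto.mul_const (b := c * (1 - Pfin π₂ μ f ψ))
        ENNReal.tendsto_nat_nhds_top (Or.inl ENNReal.top_ne_zero)
      rwa [ENNReal.top_mul hpos] at h
    rw [hR]
    refine tendsto_nhds_top_mono' hlow fun N => ?_
    simp only [hRN]
    calc (N : ℝ≥0∞) * (c * (1 - Pfin π₂ μ f ψ))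
        = c * N * (1 - Pfin π₂ μ f ψ) := by ring
      _ ≤ c * ((N : ℝ≥0∞) + 1) * PtauGe π₂ μ f ψ (N + 1) := by
        gcongr
        · exact le_self_add
        · exact one_sub_Pfin_le_PtauGe hf hψ N
      _ ≤ _ := le_self_add.trans le_add_self
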